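/- Let E be a directed graph, let P be a proper partition of E^1 (in the in-splitting sense), let E_r(P) be the in-split graph, and let d_{r,P} be the associated Drinen range-vector with in-delayed graph d_{r,P}(E). Let {s_f, p_w : f ∈ d_{r,P}(E)^1, w ∈ d_{r,P}(E)^0} be a Cuntz-Krieger d_{r,P}(E)-family in a C*-algebra A, and adopt the convention s_{f(v)_0} = p_{v_0}. Define: T_e = s_e for e ∈ E^1 with m(s(e)) = 0; T_{e_j} = s_{f(s(e))_{j-1}} ⋯ s_{f(s(e))_1} s_e for e ∈ E^1 and 1 ≤ j ≤ m(s(e)); Q_{v_i} = p_{v_{i-1}} for v ∈ E^0 and 1 ≤ i ≤ m(v); and Q_v = p_{v_0} if m(v) = 0. Then {T_g, Q_u : g ∈ E_r(P)^1, u ∈ E_r(P)^0} is a Cuntz-Krieger E_r(P)-family in A; moreover, if every p_w is nonzero then every Q_u is nonzero. -/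

import Mathlib

/-! Statement 8: a Cuntz-Krieger family for the in-delayed graph `d_{r,P}(E)` associated
to a proper in-splitting gives rise to a Cuntz-Krieger family for the in-split graph
`E_r(P)`. -/

/-- A Cuntz-Krieger family for the directed graph with vertex type `V`, edge type `E`,
range map `r` and source map `s`, inside a C*-algebra `A`.  The relation
`S e S e* ≤ P (s e)` is phrased algebraically (for projections `p ≤ q ↔ p * q = p`). -/
structure CKFamily {A : Type} [NonUnitalCStarAlgebra A] {V E : Type}
    (r s : E → V) (S : E → A) (P : V → A) : Prop where
  partialIsom : ∀ e, S e * star (S e) * S e = S e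
  orthoRanges : ∀ e f, e ≠ f → (S e * star (S e)) * (S f * star (S f)) = 0
  projIdem : ∀ v, P v * P v = P v
  projSelfAdj : ∀ v, star (P v) = P v
  orthoProj : ∀ v w, v ≠ w → P v * P w = 0
  ck1 : ∀ e, star (S e) * S e = P (r e)
  ck2 : ∀ e, (S e * star (S e)) * P (s e) = S e * star (S e)
  ck3 : ∀ v, {e | s e = v}.Nonempty → {e | s e = v}.Finite →
      P v = ∑ᶠ e ∈ {e | s e = v}, S e * star (S e)

section InDelay

variable {V E : Type} (r s : E → V) (d : V → ℕ∞) (dE : E → ℕ)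

/-- Vertices of the in-delayed graph `d_r(E)`: pairs `v_i = (v, i)` with
`0 ≤ i ≤ d_r v`. -/
def IDVert : Type := {p : V × ℕ // (p.2 : ℕ∞) ≤ d p.1}

/-- Edges of the in-delayed graph: the original edges `e ∈ E^1` together with the
delay edges `f(v)_i`, `1 ≤ i ≤ d_r v`, encoded as pairs `(v, i)`. -/
def IDEdge (E : Type) {V : Type} (d : V → ℕ∞) : Type :=
  E ⊕ {p : V × ℕ // 1 ≤ p.2 ∧ (p.2 : ℕ∞) ≤ d p.1}

/-- The vertex `v_0` of the in-delayed graph. -/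
def idVert0 (v : V) : IDVert d := ⟨(v, 0), by simp⟩

/-- The source map of the in-delayed graph: `s(e) = s(e)_0` and `s(f(v)_i) = v_i`. -/
def idSrc : IDEdge E d → IDVert d
  | .inl e => idVert0 d (s e)
  | .inr g => ⟨g.1, g.2.2⟩

/-- The range map of the in-delayed graph: `r(e) = r(e)_{d_r e}` and
`r(f(v)_i) = v_{i-1}`.  (The hypothesis `hrd`, that `d_r e ≤ d_r (r e)`, holds for the
Drinen range-vector associated to an in-splitting.) -/
def idRng (hrd : ∀ e, (dE e : ℕ∞) ≤ d (r e)) : IDEdge E d → IDVert d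
  | .inl e => ⟨(r e, dE e), hrd e⟩
  | .inr g => ⟨(g.1.1, g.1.2 - 1), le_trans (by exact_mod_cast Nat.sub_le _ _) g.2.2⟩

end InDelay

section InSplit

variable {V E : Type} (r s : E → V) (m : V → ℕ∞) (idx : E → ℕ)

/-- Vertices of the in-split graph `E_r(P)`: pairs `v_i = (v, i)` with `1 ≤ i ≤ m v`,
together with the sources `v`, encoded as `(v, 0)` when `m v = 0`. -/
def ISVert : Type :=
  {p : V × ℕ // (p.2 = 0 ∧ m p.1 = 0) ∨ (1 ≤ p.2 ∧ (p.2 : ℕ∞) ≤ m p.1)}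

/-- Edges of the in-split graph: pairs `e_j = (e, j)` with `1 ≤ j ≤ m (s e)`, together
with the edges `e` out of sources, encoded as `(e, 0)` when `m (s e) = 0`. -/
def ISEdge : Type :=
  {p : E × ℕ // (p.2 = 0 ∧ m (s p.1) = 0) ∨ (1 ≤ p.2 ∧ (p.2 : ℕ∞) ≤ m (s p.1))}

/-- The source map of the in-split graph: `s(e_j) = s(e)_j` (and `s(e) = s(e)` for
sources). -/
def isSrc : ISEdge s m → ISVert m := fun g => ⟨(s g.1.1, g.1.2), g.2⟩

/-- The range map of the in-split graph: `r(e_j) = r(e)_i` where `e ∈ 𝓔^{r e}_i`,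
i.e. `i = idx e`. -/
def isRng (hidx : ∀ e, 1 ≤ idx e ∧ (idx e : ℕ∞) ≤ m (r e)) :
    ISEdge s m → ISVert m :=
  fun g => ⟨(r g.1.1, idx g.1.1), Or.inr (hidx g.1.1)⟩

variable {A : Type} [NonUnitalCStarAlgebra A]

/-- `descChain g x n = g n * g (n-1) * ⋯ * g 1 * x` for `n ≥ 1`, and
`descChain g x 0 = g 0 * x`. -/
def descChain (g : ℕ → A) (x : A) : ℕ → A
  | 0 => g 0 * x
  | 1 => g 1 * x
  | n + 2 => g (n + 2) * descChain g x (n + 1)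

open scoped Classical in
/-- `T_{e_j} = s_{f(s e)_{j-1}} ⋯ s_{f(s e)_1} s_e` for `1 ≤ j ≤ m (s e)` (with the
convention `s_{f(v)_0} = p_{v_0}`, implemented by the `else` branch of the inner `if`),
and `T_e = s_e` when `m (s e) = 0` (encoded as `j = 0`). -/
noncomputable def TIS (Sp : IDEdge E (fun v => m v - 1) → A)
    (Pp : IDVert (fun v => m v - 1) → A) (e : E) (j : ℕ) : A :=
  if j = 0 then Sp (.inl e)
  else
    descChain
      (fun k => if hk : 1 ≤ k ∧ (k : ℕ∞) ≤ m (s e) - 1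
        then Sp (.inr ⟨(s e, k), hk⟩)
        else Pp (idVert0 (fun v => m v - 1) (s e)))
      (Sp (.inl e)) (j - 1)

/-- `Q_{v_i} = p_{v_{i-1}}` for `1 ≤ i ≤ m v`, and `Q_v = p_{v_0}` when `m v = 0`
(encoded as `i = 0`, with `0 - 1 = 0`). -/
noncomputable def QIS (Pp : IDVert (fun v => m v - 1) → A) (u : ISVert m) : A :=
  Pp ⟨(u.1.1, u.1.2 - 1), by
    rcases u.2 with ⟨h0, _⟩ | ⟨h1, h2⟩
    · simp [h0]
    · have : ((u.1.2 - 1 : ℕ) : ℕ∞) = (u.1.2 : ℕ∞) - 1 := by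
        rw [ENat.coe_sub, Nat.cast_one]
      rw [this]
      exact tsub_le_tsub_right h2 1⟩

end InSplit

namespace CKFamily

variable {A : Type} [NonUnitalCStarAlgebra A] {V E : Type} {r s : E → V} {S : E → A} {P : V → A}

theorem proj_src_mul (h : CKFamily r s S P) (e : E) : P (s e) * S e = S e := by
  have h2 := congrArg star (h.ck2 e)
  simp only [star_mul, star_star, h.projSelfAdj] at h2
  calc P (s e) * S e = P (s e) * (S e * star (S e)) * S e := by
        rw [mul_assoc, h.partialIsom]
    _ = S e := by rw [h2, h.partialIsom]

theorem mul_proj_rng (h : CKFamily r s S P) (e : E) : S e * P (r e) = S e := by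
  rw [← h.ck1, ← mul_assoc, h.partialIsom]

theorem star_mul_eq_zero (h : CKFamily r s S P) {e f : E} (hef : e ≠ f) :
    star (S e) * S f = 0 := by
  have he := congrArg star (h.partialIsom e)
  simp only [star_mul, star_star] at he
  calc star (S e) * S f = star (S e) * (S e * star (S e) * (S f * star (S f))) * S f := by
        nth_rw 1 [← he, ← h.partialIsom f]
        simp only [mul_assoc]
    _ = 0 := by rw [h.orthoRanges e f hef]; simp

/-- A vertex emitting exactly one edge has projection equal to the range projection of
that edge. -/
theorem proj_eq_of_unique (h : CKFamily r s S P) {v : V} {e : E}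
    (he : {f | s f = v} = {e}) : P v = S e * star (S e) := by
  rw [h.ck3 v (by simp [he]) (by simp [he]), he, finsum_mem_singleton]

end CKFamily

section DelayPath

variable {A : Type} [NonUnitalCStarAlgebra A] {V E : Type} {r s : E → V} {m : V → ℕ∞}
  {dE : E → ℕ} {hrd : ∀ e, (dE e : ℕ∞) ≤ m (r e) - 1}
  {Sp : IDEdge E (fun v => m v - 1) → A} {Pp : IDVert (fun v => m v - 1) → A}

theorem descChain_succ (g : ℕ → A) (x : A) (n : ℕ) (h0 : g 0 * x = x) :
    descChain g x (n + 1) = g (n + 1) * descChain g x n := by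
  cases n with
  | zero => simp [descChain, h0]
  | succ n => rfl

open scoped Classical in
/-- The partial isometry of the path `f(v)_n ⋯ f(v)_1` of delay edges. -/
theorem exists_delayPath
    (h : CKFamily (idRng r (fun v => m v - 1) dE hrd) (idSrc s (fun v => m v - 1)) Sp Pp)
    (v : V) (n : ℕ) (hn : (n : ℕ∞) ≤ m v - 1) :
    ∃ F : A, star F * F = Pp (idVert0 _ v) ∧ F * star F = Pp ⟨(v, n), hn⟩ ∧
      F * Pp (idVert0 _ v) = F ∧
      ∀ x, Pp (idVert0 _ v) * x = x →
        descChain (fun k => if hk : 1 ≤ k ∧ (k : ℕ∞) ≤ m v - 1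
          then Sp (.inr ⟨(v, k), hk⟩) else Pp (idVert0 (fun v => m v - 1) v)) x n = F * x := by
  induction n with
  | zero =>
    refine ⟨Pp (idVert0 _ v), ?_, ?_, h.projIdem _, fun x _ => by simp [descChain]⟩
    · rw [h.projSelfAdj, h.projIdem]
    · rw [h.projSelfAdj, h.projIdem]; rfl
  | succ n ih =>
    have hn' : (n : ℕ∞) ≤ m v - 1 := le_trans (by exact_mod_cast Nat.le_succ n) hn
    obtain ⟨F, h1, h2, h3, h4⟩ := ih hn'
    let f : IDEdge E (fun v => m v - 1) := .inr ⟨(v, n + 1), by simp, hn⟩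
    have hr : Pp (idRng r (fun v => m v - 1) dE hrd f) = F * star F := by
      rw [h2]; rfl
    have hs : Pp ⟨(v, n + 1), hn⟩ = Sp f * star (Sp f) := by
      apply h.proj_eq_of_unique
      ext g
      constructor
      · intro hg
        change idSrc s (fun v => m v - 1) g = ⟨(v, n + 1), hn⟩ at hg
        rcases g with e | g
        · have := congrArg (fun w => w.1.2) hg
          simp [idSrc, idVert0] at this
        · have hg' : g.1 = (v, n + 1) := congrArg (fun w => w.1) hg
          exact congrArg Sum.inr (Subtype.ext hg')
      · rintro rfl; rfl
    refine ⟨Sp f * F, ?_, ?_, by rw [mul_assoc, h3], fun x hx => ?_⟩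
    · calc star (Sp f * F) * (Sp f * F) = star F * (star (Sp f) * Sp f) * F := by
            simp only [star_mul, mul_assoc]
        _ = (star F * F) * (star F * F) := by rw [h.ck1, hr]; simp only [mul_assoc]
        _ = Pp (idVert0 _ v) := by rw [h1, h.projIdem]
    · calc Sp f * F * star (Sp f * F) = Sp f * (F * star F) * star (Sp f) := by
            simp only [star_mul, mul_assoc]
        _ = Pp ⟨(v, n + 1), hn⟩ := by rw [← hr, h.mul_proj_rng, hs]
    · rw [descChain_succ _ _ _ (by simpa using hx), h4 x hx, dif_pos ⟨by simp, hn⟩, mul_assoc]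

/-- Each in-split edge acts as the original edge followed by a partial isometry depending
only on its source. -/
theorem exists_TIS_eq_mul
    (h : CKFamily (idRng r (fun v => m v - 1) dE hrd) (idSrc s (fun v => m v - 1)) Sp Pp)
    (u : ISVert m) :
    ∃ F : A, star F * F = Pp (idVert0 _ u.1.1) ∧ F * star F = QIS m Pp u ∧
      F * Pp (idVert0 _ u.1.1) = F ∧
      ∀ e, s e = u.1.1 → TIS s m Sp Pp e u.1.2 = F * Sp (.inl e) := by
  obtain ⟨⟨v, j⟩, hu⟩ := u
  obtain ⟨F, h1, h2, h3, h4⟩ := exists_delayPath h v (j - 1) (by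
    rcases hu with ⟨h0, _⟩ | ⟨_, hj⟩
    · simp [show j = 0 from h0]
    · rw [ENat.natCast_sub, Nat.cast_one]
      exact tsub_le_tsub_right hj 1)
  refine ⟨F, h1, h2, h3, ?_⟩
  rintro e rfl
  have hx : Pp (idVert0 _ (s e)) * Sp (.inl e) = Sp (.inl e) := h.proj_src_mul (.inl e)
  rw [← h4 _ hx]
  by_cases hj : j = 0
  · simp [TIS, hj, descChain, hx]
  · simp [TIS, hj]

end DelayPath

/-- The in-split vertex `v_i` determines and is determined by the in-delayed vertex
`v_{i-1}`. -/
theorem ISVert.ext_of_pred {V : Type} {m : V → ℕ∞} {u w : ISVert m} (h : u.1.1 = w.1.1)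
    (h' : u.1.2 - 1 = w.1.2 - 1) : u = w := by
  obtain ⟨⟨a, i⟩, hu⟩ := u
  obtain ⟨⟨b, j⟩, hw⟩ := w
  obtain rfl : a = b := h
  have hij : i = j := by
    dsimp only at hu hw h'
    rcases hu with ⟨hi, hm⟩ | ⟨hi, hm⟩ <;> rcases hw with ⟨hj, hm'⟩ | ⟨hj, hm'⟩
    · omega
    · rw [hm] at hm'
      have : j = 0 := by simpa using hm'
      omega
    · rw [hm'] at hm
      have : i = 0 := by simpa using hm
      omega
    · omega
  subst hij
  rfl

/-- A Cuntz-Krieger family for the in-delayed graph induces one for the in-split graph.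
Neither properness of the partition nor finiteness of `m` is needed. -/
theorem CKFamily.inSplit {A : Type} [NonUnitalCStarAlgebra A] {V E : Type} {r s : E → V}
    {m : V → ℕ∞} {idx : E → ℕ}
    (hidx : ∀ e, 1 ≤ idx e ∧ (idx e : ℕ∞) ≤ m (r e))
    {hrd : ∀ e, ((idx e - 1 : ℕ) : ℕ∞) ≤ m (r e) - 1}
    {Sp : IDEdge E (fun v => m v - 1) → A} {Pp : IDVert (fun v => m v - 1) → A}
    (hfam : CKFamily (idRng r (fun v => m v - 1) (fun e => idx e - 1) hrd)
      (idSrc s (fun v => m v - 1)) Sp Pp) :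
    CKFamily (isRng r s m idx hidx) (isSrc s m)
      (fun g : ISEdge s m => TIS s m Sp Pp g.1.1 g.1.2) (QIS m Pp) := by
  choose F hF0 hFQ hFP hFT using exists_TIS_eq_mul hfam
  have hT : ∀ g : ISEdge s m,
      TIS s m Sp Pp g.1.1 g.1.2 = F (isSrc s m g) * Sp (.inl g.1.1) :=
    fun g => hFT (isSrc s m g) g.1.1 rfl
  have hQF : ∀ u, QIS m Pp u * F u = F u := fun u => by
    rw [← hFQ, mul_assoc, hF0, hFP]
  have hQproj : ∀ u w, u ≠ w → QIS m Pp u * QIS m Pp w = 0 := fun u w huw =>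
    hfam.orthoProj _ _ fun h => huw <|
      ISVert.ext_of_pred (congrArg (fun z => z.1.1) h) (congrArg (fun z => z.1.2) h)
  have hcross : ∀ g g' : ISEdge s m, isSrc s m g = isSrc s m g' →
      star (TIS s m Sp Pp g.1.1 g.1.2) * TIS s m Sp Pp g'.1.1 g'.1.2 =
        star (Sp (.inl g.1.1)) * Sp (.inl g'.1.1) := fun g g' hg => by
    have h0 : Pp (idVert0 _ (s g'.1.1)) * Sp (.inl g'.1.1) = Sp (.inl g'.1.1) :=
      hfam.proj_src_mul (.inl g'.1.1)
    rw [hT, hT, hg, star_mul, mul_assoc, ← mul_assoc (star (F _)), hF0]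
    exact congrArg _ h0
  have hQT : ∀ g : ISEdge s m, QIS m Pp (isSrc s m g) * TIS s m Sp Pp g.1.1 g.1.2 =
      TIS s m Sp Pp g.1.1 g.1.2 := fun g => by
    rw [hT, ← mul_assoc, hQF]
  have hQsa : ∀ u, star (QIS m Pp u) = QIS m Pp u := fun u => hfam.projSelfAdj _
  have hTQ : ∀ g : ISEdge s m, star (TIS s m Sp Pp g.1.1 g.1.2) * QIS m Pp (isSrc s m g) =
      star (TIS s m Sp Pp g.1.1 g.1.2) := fun g => by
    have := congrArg star (hQT g)
    rwa [star_mul, hQsa] at this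
  refine ⟨fun g => ?_, fun g g' hg => ?_, fun u => hfam.projIdem _, hQsa, hQproj, fun g => ?_,
    fun g => ?_, fun u hne hfin => ?_⟩
  · rw [mul_assoc, hcross g g rfl, hT, mul_assoc]
    refine congrArg (F (isSrc s m g) * ·) ?_
    rw [← mul_assoc]
    exact hfam.partialIsom (.inl g.1.1)
  · have hz : star (TIS s m Sp Pp g.1.1 g.1.2) * TIS s m Sp Pp g'.1.1 g'.1.2 = 0 := by
      by_cases hs : isSrc s m g = isSrc s m g'
      · rw [hcross g g' hs]
        refine hfam.star_mul_eq_zero fun h => hg ?_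
        exact Subtype.ext (Prod.ext (Sum.inl_injective h) (congrArg (fun z => z.1.2) hs))
      · rw [← hTQ g, ← hQT g', mul_assoc, ← mul_assoc (QIS m Pp _), hQproj _ _ hs]
        simp
    rw [mul_assoc, ← mul_assoc (star _), hz]
    simp
  · exact (hcross g g rfl).trans (hfam.ck1 (.inl g.1.1))
  · rw [mul_assoc, hTQ]
  · obtain ⟨⟨v, j⟩, hu⟩ := u
    let ι : E → IDEdge E (fun v => m v - 1) := Sum.inl
    have hinj : Function.Injective ι := Sum.inl_injective
    have himg : {f | idSrc s (fun v => m v - 1) f = idVert0 _ v} =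
        ι '' {e | s e = v} := by
      ext f
      constructor
      · intro hf
        change idSrc s (fun v => m v - 1) f = idVert0 _ v at hf
        rcases f with e | f
        · have he : s e = v := congrArg (fun z => z.1.1) hf
          exact ⟨e, he, rfl⟩
        · have h0 : f.1.2 = 0 := congrArg (fun z => z.1.2) hf
          have h1 := f.2.1
          omega
      · rintro ⟨e, rfl, rfl⟩
        rfl
    have himg' : (fun g : ISEdge s m => g.1.1) '' {g | isSrc s m g = ⟨(v, j), hu⟩} =
        {e | s e = v} := by
      ext e
      constructor
      · rintro ⟨g, hg, rfl⟩
        have hg : isSrc s m g = ⟨(v, j), hu⟩ := hg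
        exact congrArg (fun z => z.1.1) hg
      · rintro rfl
        exact ⟨⟨(e, j), hu⟩, rfl, rfl⟩
    have hinj' : Set.InjOn (fun g : ISEdge s m => g.1.1)
        {g | isSrc s m g = ⟨(v, j), hu⟩} := fun g hg g' hg' h =>
      Subtype.ext (Prod.ext h (congrArg (fun z => z.1.2) (hg.trans hg'.symm)))
    have hP0 := hfam.ck3 (idVert0 _ v)
      (by rw [himg, ← himg']; exact (hne.image _).image _)
      (by rw [himg, ← himg']; exact (hfin.image _).image _)
    rw [himg, finsum_mem_image hinj.injOn, ← himg', finsum_mem_image hinj'] at hP0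
    set u : ISVert m := ⟨(v, j), hu⟩ with hu_def
    let φ : A →+ A := (AddMonoidHom.mulLeft (F u)).comp (AddMonoidHom.mulRight (star (F u)))
    calc QIS m Pp u = φ (Pp (idVert0 _ v)) := by
          change _ = F u * (Pp (idVert0 _ v) * star (F u))
          rw [← mul_assoc, hFP u, hFQ]
      _ = _ := by
          rw [hP0, φ.map_finsum_mem _ hfin]
          refine finsum_mem_congr rfl fun g hg => ?_
          have hg : isSrc s m g = u := hg
          change F u * (_ * star (F u)) = _
          rw [hT, hg, star_mul]
          simp only [mul_assoc]
          rfl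

/-- Let `E` be a directed graph (countable vertex and edge sets),
`𝓟` a proper partition of `E^1` in the in-splitting sense (encoded by `m : V → ℕ∞` and
`idx : E → ℕ`), `E_r(𝓟)` the in-split graph and `d_{r,𝓟}` the associated Drinen
range-vector (`d_{r,𝓟} v = m v - 1`, `d_{r,𝓟} e = idx e - 1`).  If `{s_f, p_w}` is a
Cuntz-Krieger `d_{r,𝓟}(E)`-family in a C*-algebra `A` then, with the convention
`s_{f(v)_0} = p_{v_0}`, the family `{T_g, Q_u}` is a Cuntz-Krieger `E_r(𝓟)`-family in
`A`; moreover if every `p_w` is nonzero then every `Q_u` is nonzero. -/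
theorem insplit_CK_family {A : Type} [NonUnitalCStarAlgebra A]
    {V E : Type} [Countable V] [Countable E] (r s : E → V)
    (m : V → ℕ∞) (idx : E → ℕ)
    (hsrc : ∀ v, m v = 0 ↔ {e | r e = v} = ∅)
    (hidx : ∀ e, 1 ≤ idx e ∧ (idx e : ℕ∞) ≤ m (r e))
    (hcls : ∀ v k, 1 ≤ k → (k : ℕ∞) ≤ m v → ∃ e, r e = v ∧ idx e = k)
    (hproper : ∀ v, ({e | s e = v} = ∅ ∨ {e | s e = v}.Infinite) → m v ≤ 1)
    (hrd : ∀ e, ((idx e - 1 : ℕ) : ℕ∞) ≤ m (r e) - 1)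
    (Sp : IDEdge E (fun v => m v - 1) → A) (Pp : IDVert (fun v => m v - 1) → A)
    (hfam : CKFamily (idRng r (fun v => m v - 1) (fun e => idx e - 1) hrd)
      (idSrc s (fun v => m v - 1)) Sp Pp) :
    CKFamily (isRng r s m idx hidx) (isSrc s m)
      (fun g : ISEdge s m => TIS s m Sp Pp g.1.1 g.1.2) (QIS m Pp) ∧
      ((∀ w, Pp w ≠ 0) → ∀ u, QIS m Pp u ≠ 0) := by
  exact ⟨hfam.inSplit hidx, fun hP u => hP _⟩
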